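/- arXiv:1203.6723 — 3 statements merged into one kernel-verified Lean document; each statement's English description precedes it below -/
import Mathlib

section
/- In the continuous-time defaultable bond model with λ > 0 and R ∈ (0,100], fix a maturity T > 0. If 0 ≤ C_1 < C_2 and y_T(C_1), y_T(C_2) are the corresponding yields-to-maturity, then y_T(C_1) < y_T(C_2); that is, the yield-to-maturity of the bond is a strictly increasing function of the coupon C. -/
/-- Price of a defaultable coupon bond in the continuous-time intensity model. -/
noncomputable def bondPriceC (r lam R C T : ℝ) : ℝ :=
  (C + R * lam) / (r + lam) * (1 - Real.exp (-(r + lam) * T)) +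
    100 * Real.exp (-(r + lam) * T)

/-- Present value of the nominal cash flows (continuous coupon `C`, nominal 100,
maturity `T`) discounted at rate `y`. -/
noncomputable def bondPVC (C y T : ℝ) : ℝ :=
  C * (∫ t in (0 : ℝ)..T, Real.exp (-y * t)) + 100 * Real.exp (-y * T)

theorem aux_strict (T : ℝ) (hT : 0 < T) (a b : ℝ) (hab : a < b) :
    (∫ t in (0 : ℝ)..T, Real.exp (-b * t)) < ∫ t in (0 : ℝ)..T, Real.exp (-a * t) := by
  apply intervalIntegral.integral_lt_integral_of_continuousOn_of_le_of_exists_lt hT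
  · fun_prop
  · fun_prop
  · intro x hx
    apply Real.exp_le_exp.mpr
    nlinarith [hx.1]
  · refine ⟨T, ⟨hT.le, le_refl T⟩, ?_⟩
    apply Real.exp_lt_exp.mpr
    nlinarith

theorem aux_val (T k : ℝ) (hk : 0 < k) :
    (∫ t in (0 : ℝ)..T, Real.exp (-k * t)) = (1 - Real.exp (-k * T)) / k := by
  rw [intervalIntegral.integral_comp_mul_left (fun x => Real.exp x) (neg_ne_zero.mpr hk.ne'),
    integral_exp]
  simp only [smul_eq_mul, mul_zero, Real.exp_zero]
  field_simp
  ring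

/-- With `λ > 0` and `R ∈ (0,100]`, for a fixed maturity `T > 0`,
if `0 ≤ C₁ < C₂` then the corresponding yields-to-maturity satisfy `y_T(C₁) < y_T(C₂)`:
the yield-to-maturity is strictly increasing in the coupon. -/
theorem ytm_increasing_in_coupon_continuous (r lam R : ℝ) (hr : 0 ≤ r) (hlam : 0 < lam)
    (hR : R ∈ Set.Ioc (0 : ℝ) 100) (T : ℝ) (hT : 0 < T)
    (C₁ C₂ y₁ y₂ : ℝ) (hC₁ : 0 ≤ C₁) (hC : C₁ < C₂)
    (heq₁ : bondPriceC r lam R C₁ T = bondPVC C₁ y₁ T)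
    (heq₂ : bondPriceC r lam R C₂ T = bondPVC C₂ y₂ T) :
    y₁ < y₂ := by
  obtain ⟨hR0, -⟩ := hR
  have hk : 0 < r + lam := by linarith
  unfold bondPriceC bondPVC at heq₁ heq₂
  have hv := aux_val T (r + lam) hk
  have hmono := aux_strict T hT
  have hAk : 0 < ∫ t in (0 : ℝ)..T, Real.exp (-(r + lam) * t) := by
    apply intervalIntegral.intervalIntegral_pos_of_pos _ (fun x => Real.exp_pos _) hT
    exact Continuous.intervalIntegrable (by fun_prop) _ _
  have hp : ∀ C : ℝ, (C + R * lam) / (r + lam) * (1 - Real.exp (-(r + lam) * T))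
      = (C + R * lam) * ∫ t in (0 : ℝ)..T, Real.exp (-(r + lam) * t) := by
    intro C
    rw [hv]; ring
  rw [hp] at heq₁ heq₂
  clear hp hv
  have hexp : ∀ a b : ℝ, a ≤ b → Real.exp (-b * T) ≤ Real.exp (-a * T) := by
    intro a b hab
    apply Real.exp_le_exp.mpr
    nlinarith
  have hmono' : ∀ a b : ℝ, a ≤ b →
      (∫ t in (0 : ℝ)..T, Real.exp (-b * t)) ≤ ∫ t in (0 : ℝ)..T, Real.exp (-a * t) := by
    intro a b hab
    rcases hab.lt_or_eq with h | h
    · exact (hmono a b h).le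
    · rw [h]
  generalize r + lam = k at *
  have hRl : 0 < R * lam := mul_pos hR0 hlam
  have hy : y₁ < k := by
    by_contra! h
    have h1 := mul_le_mul_of_nonneg_left (hmono' _ _ h) hC₁
    have h2 := hexp _ _ h
    have h3 := mul_pos hRl hAk
    linarith
  by_contra! h
  have h1 := mul_le_mul_of_nonneg_left (hmono' _ _ h) (hC₁.trans hC.le)
  have h2 := hexp _ _ h
  have h3 := mul_pos (sub_pos.mpr hC) (sub_pos.mpr (hmono _ _ hy))
  linarith
end

section
/- In the continuous-time defaultable bond model with λ > 0 and R ∈ (0,100], for every maturity T > 0 and every coupon C ≥ 0 the yield-to-maturity satisfies y_T(C) < c_par + δ_sup, where c_par = r + (1 - R/100)λ and δ_sup = Rλ/100; equivalently, y_T(C) < r + λ, an upper bound that does not depend on the coupon. -/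
/-- With `λ > 0` and `R ∈ (0,100]`, the yield-to-maturity of any bond
(maturity `T > 0`, coupon `C ≥ 0`) is bounded above by `c_par + δ_sup`, where
`c_par = r + (1 - R/100)λ` and `δ_sup = Rλ/100`, i.e. `y_T(C) < r + λ`:
a bound independent of the coupon. -/
theorem ytm_upper_bound_continuous (r lam R : ℝ) (hr : 0 ≤ r) (hlam : 0 < lam)
    (hR : R ∈ Set.Ioc (0 : ℝ) 100) (T : ℝ) (hT : 0 < T) (C : ℝ) (hC : 0 ≤ C)
    (y : ℝ) (heq : bondPriceC r lam R C T = bondPVC C y T) :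
    y < (r + (1 - R / 100) * lam) + R * lam / 100 ∧ y < r + lam := by
  have key : y < r + lam := by
    by_contra! hy
    have hs : 0 < r + lam := by linarith
    have hE : Real.exp (-(r + lam) * T) < 1 := by
      rw [Real.exp_lt_one_iff]
      nlinarith [mul_pos hs hT]
    have hI : (∫ t in (0 : ℝ)..T, Real.exp (-(r + lam) * t))
        = (1 - Real.exp (-(r + lam) * T)) / (r + lam) := by
      have hne : -(r + lam) ≠ 0 := neg_ne_zero.mpr hs.ne'
      rw [intervalIntegral.integral_comp_mul_left (fun x => Real.exp x) hne, integral_exp]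
      simp only [mul_zero, Real.exp_zero, smul_eq_mul]
      field_simp
      ring
    have hmono : (∫ t in (0 : ℝ)..T, Real.exp (-y * t))
        ≤ ∫ t in (0 : ℝ)..T, Real.exp (-(r + lam) * t) := by
      apply intervalIntegral.integral_mono_on hT.le
      · exact Continuous.intervalIntegrable (by fun_prop) _ _
      · exact Continuous.intervalIntegrable (by fun_prop) _ _
      · intro t ht
        apply Real.exp_le_exp.mpr
        nlinarith [ht.1]
    have hexp : Real.exp (-y * T) ≤ Real.exp (-(r + lam) * T) := by
      apply Real.exp_le_exp.mpr
      nlinarith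
    have h1 := mul_le_mul_of_nonneg_left hmono hC
    rw [hI] at h1
    have hpos : 0 < R * lam * ((1 - Real.exp (-(r + lam) * T)) / (r + lam)) :=
      mul_pos (mul_pos hR.1 hlam) (div_pos (by linarith) hs)
    unfold bondPriceC bondPVC at heq
    have h2 : (C + R * lam) / (r + lam) * (1 - Real.exp (-(r + lam) * T))
        = C * ((1 - Real.exp (-(r + lam) * T)) / (r + lam))
          + R * lam * ((1 - Real.exp (-(r + lam) * T)) / (r + lam)) := by ring
    linarith
  exact ⟨by linarith, key⟩
end

section
/- In the continuous-time defaultable bond model with λ > 0 and R ∈ (0,100], set C_par = 100·r + (100 - R)·λ. If the coupon satisfies C > C_par, then the yield-to-maturity term structure is strictly increasing in maturity: for all 0 < T < T', y_T(C) < y_{T'}(C). If C < C_par, then for all 0 < T < T', y_T(C) > y_{T'}(C). If C = C_par, then y_T(C) = C_par/100 for every T > 0. -/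
/-- Par coupon in the continuous-time model. -/
noncomputable def parCouponC (r lam R : ℝ) : ℝ := 100 * r + (100 - R) * lam

noncomputable def annA (y T : ℝ) : ℝ := ∫ t in (0 : ℝ)..T, Real.exp (-y * t)

lemma annA_ii (y a b : ℝ) :
    IntervalIntegrable (fun t => Real.exp (-y * t)) MeasureTheory.volume a b :=
  Continuous.intervalIntegrable (by fun_prop) _ _

lemma annA_mul (y T : ℝ) : y * annA y T = 1 - Real.exp (-y * T) := by
  have h : ∀ t ∈ Set.uIcc 0 T,
      HasDerivAt (fun t => - Real.exp (-y * t)) (y * Real.exp (-y * t)) t := by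
    intro t _
    have h1 : HasDerivAt (fun t : ℝ => -y * t) (-y) t := by
      simpa using (hasDerivAt_id t).const_mul (-y)
    have h2 := h1.exp.neg
    have e : -(Real.exp (-y * t) * -y) = y * Real.exp (-y * t) := by ring
    rw [e] at h2
    exact h2
  have := intervalIntegral.integral_eq_sub_of_hasDerivAt h ((annA_ii y 0 T).const_mul y)
  rw [intervalIntegral.integral_const_mul] at this
  rw [annA, this]
  simp
  ring

lemma annA_pos (y T : ℝ) (hT : 0 < T) : 0 < annA y T :=
  intervalIntegral.intervalIntegral_pos_of_pos (annA_ii y 0 T) (fun _ => Real.exp_pos _) hT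

lemma annA_anti (y z T : ℝ) (hT : 0 < T) (h : y ≤ z) : annA z T ≤ annA y T := by
  apply intervalIntegral.integral_mono_on hT.le (annA_ii _ _ _) (annA_ii _ _ _)
  intro t ht
  apply Real.exp_le_exp.mpr
  nlinarith [ht.1]

lemma annA_ratio (y k T T' : ℝ) (hyk : y < k) (hT : 0 < T) (hTT : T < T') :
    annA k T' * annA y T < annA k T * annA y T' := by
  have split : ∀ z, annA z T' = annA z T + ∫ t in T..T', Real.exp (-z * t) := fun z =>
    (intervalIntegral.integral_add_adjacent_intervals (annA_ii z 0 T) (annA_ii z T T')).symm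
  rw [split k, split y]
  have hBy : 0 < ∫ t in T..T', Real.exp (-y * t) :=
    intervalIntegral.intervalIntegral_pos_of_pos (annA_ii y T T') (fun _ => Real.exp_pos _) hTT
  have h1 : (∫ t in T..T', Real.exp (-k * t)) ≤
      Real.exp (-(k - y) * T) * ∫ t in T..T', Real.exp (-y * t) := by
    rw [← intervalIntegral.integral_const_mul]
    apply intervalIntegral.integral_mono_on hTT.le (annA_ii _ _ _)
      ((annA_ii _ _ _).const_mul _)
    intro t ht
    rw [← Real.exp_add]
    apply Real.exp_le_exp.mpr
    nlinarith [ht.1]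
  have h2 : Real.exp (-(k - y) * T) * annA y T < annA k T := by
    rw [annA, annA, ← intervalIntegral.integral_const_mul]
    apply intervalIntegral.integral_lt_integral_of_continuousOn_of_le_of_exists_lt hT
    · fun_prop
    · fun_prop
    · intro t ht
      rw [← Real.exp_add]
      apply Real.exp_le_exp.mpr
      nlinarith [ht.2]
    · refine ⟨0, ⟨le_rfl, hT.le⟩, ?_⟩
      rw [← Real.exp_add]
      apply Real.exp_lt_exp.mpr
      nlinarith
  have hA := annA_pos y T hT
  have h3 := mul_le_mul_of_nonneg_right h1 hA.le
  have h4 := mul_lt_mul_of_pos_right h2 hBy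
  nlinarith

lemma pv_eq (C y T : ℝ) : bondPVC C y T = 100 + (C - 100 * y) * annA y T := by
  have := annA_mul y T
  have h : bondPVC C y T = C * annA y T + 100 * Real.exp (-y * T) := rfl
  rw [h]
  linarith

lemma price_eq (r lam R C T : ℝ) (hk : 0 < r + lam) :
    bondPriceC r lam R C T = 100 + (C - parCouponC r lam R) * annA (r + lam) T := by
  have := annA_mul (r + lam) T
  rw [bondPriceC, parCouponC,
    show Real.exp (-(r + lam) * T) = 1 - (r + lam) * annA (r + lam) T by linarith]
  field_simp
  ring

lemma pv_anti (C y z T : ℝ) (hC : 0 ≤ C) (hT : 0 < T) (h : y < z) :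
    bondPVC C z T < bondPVC C y T := by
  have h1 : C * annA z T ≤ C * annA y T :=
    mul_le_mul_of_nonneg_left (annA_anti y z T hT h.le) hC
  have h2 : Real.exp (-z * T) < Real.exp (-y * T) := by
    apply Real.exp_lt_exp.mpr
    nlinarith
  change C * annA z T + _ < C * annA y T + _
  linarith

lemma pv_lt (C y z T : ℝ) (hC : 0 ≤ C) (hT : 0 < T) (h : bondPVC C z T < bondPVC C y T) :
    y < z := by
  by_contra hn
  rcases (not_lt.mp hn).lt_or_eq with h' | h'
  · exact absurd (pv_anti C z y T hC hT h') (not_lt.mpr h.le)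
  · subst h'
    exact lt_irrefl _ h

lemma y_lt_k (r lam R C T y : ℝ) (hr : 0 ≤ r) (hlam : 0 < lam) (hR : 0 < R) (hC : 0 ≤ C)
    (hT : 0 < T) (h : bondPriceC r lam R C T = bondPVC C y T) : y < r + lam := by
  apply pv_lt C y (r + lam) T hC hT
  rw [← h, price_eq r lam R C T (by linarith), pv_eq, parCouponC]
  have := annA_pos (r + lam) T hT
  have := mul_pos (mul_pos hR hlam) this
  nlinarith

/-- With `λ > 0` and `R ∈ (0,100]` and `C_par = 100·r + (100 - R)·λ`:
if `C > C_par` the yield-to-maturity term structure is strictly increasing in maturity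
(`y_T(C) < y_{T'}(C)` for all `0 < T < T'`); if `C < C_par` it is strictly decreasing;
if `C = C_par` then `y_T(C) = C_par/100` for every `T > 0`. -/
theorem ytm_term_structure_continuous (r lam R : ℝ) (hr : 0 ≤ r) (hlam : 0 < lam)
    (hR : R ∈ Set.Ioc (0 : ℝ) 100) (C : ℝ) (hC : 0 ≤ C) :
    (parCouponC r lam R < C →
      ∀ T T' y y' : ℝ, 0 < T → T < T' →
        bondPriceC r lam R C T = bondPVC C y T →
        bondPriceC r lam R C T' = bondPVC C y' T' → y < y') ∧
    (C < parCouponC r lam R →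
      ∀ T T' y y' : ℝ, 0 < T → T < T' →
        bondPriceC r lam R C T = bondPVC C y T →
        bondPriceC r lam R C T' = bondPVC C y' T' → y' < y) ∧
    (C = parCouponC r lam R →
      ∀ T y : ℝ, 0 < T → bondPriceC r lam R C T = bondPVC C y T →
        y = parCouponC r lam R / 100) := by
  have hk : 0 < r + lam := by linarith
  refine ⟨?_, ?_, ?_⟩
  · intro hD T T' y y' hT hTT h h'
    have hyk := y_lt_k r lam R C T y hr hlam hR.1 hC hT h
    have hrat := annA_ratio y (r + lam) T T' hyk hT hTT
    have hA := annA_pos y T hT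
    apply pv_lt C y y' T' hC (hT.trans hTT)
    rw [← h', price_eq _ _ _ _ _ hk, pv_eq]
    rw [price_eq _ _ _ _ _ hk, pv_eq] at h
    have h1 := mul_lt_mul_of_pos_left hrat (sub_pos.mpr hD)
    have h2 : (C - parCouponC r lam R) * annA (r + lam) T = (C - 100 * y) * annA y T := by
      linarith
    rw [← mul_assoc, ← mul_assoc, h2] at h1
    have : (C - parCouponC r lam R) * annA (r + lam) T' < (C - 100 * y) * annA y T' := by
      apply lt_of_mul_lt_mul_right _ hA.le
      linarith
    linarith
  · intro hD T T' y y' hT hTT h h'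
    have hyk := y_lt_k r lam R C T y hr hlam hR.1 hC hT h
    have hrat := annA_ratio y (r + lam) T T' hyk hT hTT
    have hA := annA_pos y T hT
    apply pv_lt C y' y T' hC (hT.trans hTT)
    rw [← h', price_eq _ _ _ _ _ hk, pv_eq]
    rw [price_eq _ _ _ _ _ hk, pv_eq] at h
    have h1 := mul_lt_mul_of_neg_left hrat (sub_neg.mpr hD)
    have h2 : (C - parCouponC r lam R) * annA (r + lam) T = (C - 100 * y) * annA y T := by
      linarith
    rw [← mul_assoc, ← mul_assoc, h2] at h1
    have : (C - 100 * y) * annA y T' < (C - parCouponC r lam R) * annA (r + lam) T' := by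
      apply lt_of_mul_lt_mul_right _ hA.le
      linarith
    linarith
  · intro hD T y hT h
    have hA := annA_pos y T hT
    rw [price_eq _ _ _ _ _ hk, pv_eq, ← hD] at h
    have h2 : (C - 100 * y) * annA y T = 0 := by linarith
    rcases mul_eq_zero.mp h2 with h3 | h3
    · rw [← hD]
      linarith
    · exact absurd h3 hA.ne'
end
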